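/- Let R be the ℂ-subalgebra of ℂ[s,t] generated by s², s³, t, with ideal J generated by s²t and s³t, and let R̃ be the ℂ-subalgebra of ℂ[s,t] generated by st, s², s³, t, with ideal J̃ generated by st and s²t. Then the quotient rings R/J and R̃/J̃ are isomorphic as ℂ-algebras. -/

import Mathlib

open MvPolynomial

noncomputable section

/-- The polynomial ring ℂ[s, t]. -/
abbrev Pst : Type := MvPolynomial (Fin 2) ℂ

/-- The variable `s`. -/
def s : Pst := X 0

/-- The variable `t`. -/
def t : Pst := X 1

/-- `R = ℂ[s², s³, t]`, the non-normal affine semigroup ring, as a subalgebra of ℂ[s, t]. -/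
def R : Subalgebra ℂ Pst := Algebra.adjoin ℂ {s ^ 2, s ^ 3, t}

/-- `J = ⟨s²t, s³t⟩`, the interior radical ideal of `R`. -/
def J : Ideal R :=
  Ideal.span {x : R | (x : Pst) = s ^ 2 * t ∨ (x : Pst) = s ^ 3 * t}

/-- `R̃ = ℂ[st, s², s³, t]`, the non-scored affine semigroup ring, as a subalgebra of
ℂ[s, t]. -/
def Rt : Subalgebra ℂ Pst := Algebra.adjoin ℂ {s * t, s ^ 2, s ^ 3, t}

/-- `J̃ = ⟨st, s²t⟩`, the interior radical ideal of `R̃`. -/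
def Jt : Ideal Rt :=
  Ideal.span {x : Rt | (x : Pst) = s * t ∨ (x : Pst) = s ^ 2 * t}

lemma R_le_Rt : _root_.R ≤ Rt :=
  Algebra.adjoin_mono (Set.subset_insert _ _)

lemma s_pow_mem_R {k : ℕ} (hk : k ≠ 1) : s ^ k ∈ _root_.R := by
  have h2 : s ^ 2 ∈ _root_.R := Algebra.subset_adjoin (by simp)
  have h3 : s ^ 3 ∈ _root_.R := Algebra.subset_adjoin (by simp)
  rcases Nat.even_or_odd' k with ⟨m, rfl | rfl⟩
  · rw [pow_mul]
    exact pow_mem h2 m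
  · obtain ⟨n, rfl⟩ : ∃ n, m = n + 1 := ⟨m - 1, by omega⟩
    have h : s ^ (2 * (n + 1) + 1) = (s ^ 2) ^ n * s ^ 3 := by ring
    rw [h]
    exact mul_mem (pow_mem h2 n) h3

lemma t_pow_mem_R (k : ℕ) : t ^ k ∈ _root_.R :=
  pow_mem (Algebra.subset_adjoin (by simp)) k

/-- The substitution `t ↦ 0`. -/
def killT : Pst →ₐ[ℂ] Pst := aeval ![s, 0]

/-- The substitution `s ↦ 0`. -/
def killS : Pst →ₐ[ℂ] Pst := aeval ![0, t]

@[simp] lemma killT_s : killT s = s := by simp [killT, s]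
@[simp] lemma killT_t : killT t = 0 := by simp [killT, t]
@[simp] lemma killS_s : killS s = 0 := by simp [killS, s]
@[simp] lemma killS_t : killS t = t := by simp [killS, t]

lemma exists_monomial_of_mem_closure {m : Pst}
    (hm : m ∈ Submonoid.closure ({s ^ 2, s ^ 3, t} : Set Pst)) :
    ∃ a b : ℕ, a ≠ 1 ∧ m = s ^ a * t ^ b := by
  induction hm using Submonoid.closure_induction with
  | mem x hx =>
    rcases hx with rfl | rfl | rfl
    · exact ⟨2, 0, by simp, by simp⟩
    · exact ⟨3, 0, by simp, by simp⟩
    · exact ⟨0, 1, by simp, by simp⟩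
  | one => exact ⟨0, 0, by simp, by simp⟩
  | mul x y _ _ hx hy =>
    obtain ⟨a, b, ha, rfl⟩ := hx
    obtain ⟨c, d, hc, rfl⟩ := hy
    exact ⟨a + c, b + d, by omega, by ring⟩

lemma exists_mem_J_eq_monomial {a b : ℕ} (ha : 2 ≤ a) (hb : 1 ≤ b) :
    ∃ j ∈ J, (j : Pst) = s ^ a * t ^ b := by
  obtain ⟨b, rfl⟩ := Nat.exists_eq_add_of_le hb
  by_cases h : a = 3
  · subst h
    have hg : s ^ 3 * t ∈ _root_.R := mul_mem (s_pow_mem_R (by simp))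
      (by simpa using t_pow_mem_R 1)
    refine ⟨⟨t ^ b, t_pow_mem_R b⟩ * ⟨s ^ 3 * t, hg⟩,
      J.mul_mem_left _ (Ideal.subset_span (Or.inr rfl)), ?_⟩
    simp only [MulMemClass.coe_mul]
    ring
  · obtain ⟨a, rfl⟩ := Nat.exists_eq_add_of_le ha
    have hg : s ^ 2 * t ∈ _root_.R := mul_mem (s_pow_mem_R (by simp))
      (by simpa using t_pow_mem_R 1)
    refine ⟨⟨s ^ a * t ^ b, mul_mem (s_pow_mem_R (by omega)) (t_pow_mem_R b)⟩ *
      ⟨s ^ 2 * t, hg⟩, J.mul_mem_left _ (Ideal.subset_span (Or.inl rfl)), ?_⟩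
    simp only [MulMemClass.coe_mul]
    ring

/-- Removing from an element of `R` its pure powers of `s` and of `t` leaves an element of `J`. -/
lemma exists_mem_J_eq_sub {x : Pst} (hx : x ∈ _root_.R) :
    ∃ j ∈ J, (j : Pst) = x - killT x - killS x + killT (killS x) := by
  have hx' : x ∈ Submodule.span ℂ
      (Submonoid.closure ({s ^ 2, s ^ 3, t} : Set Pst) : Set Pst) := by
    rw [← Algebra.adjoin_eq_span]
    exact hx
  clear hx
  induction hx' using Submodule.span_induction with
  | mem x hx =>
    obtain ⟨a, b, ha, rfl⟩ := exists_monomial_of_mem_closure hx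
    rcases Nat.eq_zero_or_pos a with rfl | ha'
    · exact ⟨0, J.zero_mem, by simp⟩
    rcases Nat.eq_zero_or_pos b with rfl | hb'
    · exact ⟨0, J.zero_mem, by simp [ha'.ne']⟩
    obtain ⟨j, hj, h⟩ := exists_mem_J_eq_monomial (show 2 ≤ a by omega) hb'
    exact ⟨j, hj, by simp [h, ha'.ne', hb'.ne']⟩
  | zero => exact ⟨0, J.zero_mem, by simp⟩
  | add x y _ _ ihx ihy =>
    obtain ⟨i, hi, h⟩ := ihx
    obtain ⟨j, hj, h'⟩ := ihy
    refine ⟨i + j, J.add_mem hi hj, ?_⟩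
    simp only [AddMemClass.coe_add, h, h', map_add]
    ring
  | smul c x _ ih =>
    obtain ⟨j, hj, h⟩ := ih
    refine ⟨c • j, Submodule.smul_of_tower_mem J c hj, ?_⟩
    simp only [SetLike.val_smul, h, map_smul, smul_sub, smul_add]

lemma killT_eq_zero_of_mem_Jt {x : Rt} (hx : x ∈ Jt) : killT x = 0 := by
  have h : Jt ≤ RingHom.ker (killT.comp Rt.val) := by
    refine Ideal.span_le.2 fun y hy => ?_
    rcases hy with hy | hy <;> simp [RingHom.mem_ker, hy]
  simpa [RingHom.mem_ker] using h hx

lemma killS_eq_zero_of_mem_Jt {x : Rt} (hx : x ∈ Jt) : killS x = 0 := by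
  have h : Jt ≤ RingHom.ker (killS.comp Rt.val) := by
    refine Ideal.span_le.2 fun y hy => ?_
    rcases hy with hy | hy <;> simp [RingHom.mem_ker, hy]
  simpa [RingHom.mem_ker] using h hx

/-- The map `R → R̃/J̃` induced by the inclusion `R ⊆ R̃`. -/
def toQuotient : _root_.R →ₐ[ℂ] Rt ⧸ Jt :=
  (Ideal.Quotient.mkₐ ℂ Jt).comp (Subalgebra.inclusion R_le_Rt)

lemma toQuotient_eq_zero_iff (x : _root_.R) :
    toQuotient x = 0 ↔ Subalgebra.inclusion R_le_Rt x ∈ Jt :=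
  Ideal.Quotient.eq_zero_iff_mem

lemma ker_toQuotient : RingHom.ker toQuotient = J := by
  apply le_antisymm
  · intro x hx
    have hx' := (toQuotient_eq_zero_iff x).1 (RingHom.mem_ker.1 hx)
    have hT := killT_eq_zero_of_mem_Jt hx'
    rw [Subalgebra.coe_inclusion] at hT
    have hS := killS_eq_zero_of_mem_Jt hx'
    rw [Subalgebra.coe_inclusion] at hS
    obtain ⟨j, hj, h⟩ := exists_mem_J_eq_sub x.2
    have hjx : j = x := Subtype.ext (by simpa [hT, hS] using h)
    rwa [← hjx]
  · refine Ideal.span_le.2 fun x hx => RingHom.mem_ker.2 ((toQuotient_eq_zero_iff x).2 ?_)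
    rcases hx with hx | hx
    · refine Ideal.subset_span (Or.inr ?_)
      rwa [Subalgebra.coe_inclusion]
    · have hst : s * t ∈ Rt := Algebra.subset_adjoin (by simp)
      have h2 : s ^ 2 ∈ Rt := Algebra.subset_adjoin (by simp)
      have h : Subalgebra.inclusion R_le_Rt x = ⟨s ^ 2, h2⟩ * ⟨s * t, hst⟩ := by
        apply Subtype.ext
        rw [Subalgebra.coe_inclusion, hx, MulMemClass.coe_mul]
        ring
      rw [h]
      exact Jt.mul_mem_left _ (Ideal.subset_span (Or.inl rfl))

lemma toQuotient_surjective : Function.Surjective toQuotient := by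
  intro y
  obtain ⟨⟨x, hx⟩, rfl⟩ := Ideal.Quotient.mkₐ_surjective ℂ Jt y
  change Ideal.Quotient.mkₐ ℂ Jt ⟨x, hx⟩ ∈ toQuotient.range
  induction hx using Algebra.adjoin_induction with
  | mem x hx =>
    rcases hx with rfl | hx
    · have h : Ideal.Quotient.mkₐ ℂ Jt ⟨s * t, Algebra.subset_adjoin (by simp)⟩ = 0 :=
        Ideal.Quotient.eq_zero_iff_mem.2 (Ideal.subset_span (Or.inl rfl))
      rw [h]
      exact zero_mem _
    · exact ⟨⟨x, Algebra.subset_adjoin hx⟩, rfl⟩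
  | algebraMap c => exact ⟨algebraMap ℂ _root_.R c, rfl⟩
  | add x y hx hy ihx ihy => exact add_mem ihx ihy
  | mul x y hx hy ihx ihy => exact mul_mem ihx ihy

/-- The quotients `R/J` and `R̃/J̃` are isomorphic as ℂ-algebras. -/
theorem statement19 : Nonempty ((R ⧸ J) ≃ₐ[ℂ] (Rt ⧸ Jt)) :=
  ⟨(Ideal.quotientEquivAlgOfEq ℂ ker_toQuotient.symm).trans
    (Ideal.quotientKerAlgEquivOfSurjective toQuotient_surjective)⟩

end
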